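/- arXiv:1007.0069 — 10 statements merged into one kernel-verified Lean document; each statement's English description precedes it below -/
import Mathlib

section
/- For pairwise disjoint finite subsets A, B, C of ι and integers s, t, the following identity holds in R: w_{A∪B}^{(s)} · w_{A∪C}^{(t)} = ∑_{T⊆A} (∏_{i∈T} wᵢ) · w_{T∪B∪C}^{(s+t)} + (−1)^{s+|A|+|B|} · ∑_{S⊆B} (−1)^{|S|} (∏_{i∈S} wᵢ) · w_{C∪(B∖S)}^{(s+t)}, where the sums run over all subsets T of A and all subsets S of B respectively. (This is the identity, after complexification, expressing relations (I) of Theorem 3.2 describing the ring KO*(BT^m).) -/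
open Finset

/-- `wᵢ = zᵢ − zᵢ⁻¹` in `R`. -/
def ww {R : Type*} [CommRing R] {ι : Type*} (z : ι → Rˣ) (i : ι) : R :=
  ((z i : Rˣ) : R) - (((z i)⁻¹ : Rˣ) : R)

/-- `w_S^{(s)} = ∏_{i∈S} zᵢ + (−1)^{s+|S|} ∏_{i∈S} zᵢ⁻¹`. -/
def wS {R : Type*} [CommRing R] {ι : Type*} (z : ι → Rˣ) (S : Finset ι) (s : ℤ) : R :=
  (∏ i ∈ S, ((z i : Rˣ) : R)) +
    (((-1 : Rˣ) ^ (s + (S.card : ℤ)) : Rˣ) : R) * ∏ i ∈ S, (((z i)⁻¹ : Rˣ) : R)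

/-- `w_{S,T}^{(s)} = (∏_{i∈S} zᵢ)(∏_{i∈T} zᵢ⁻¹) + (−1)^{s+|S|+|T|}(∏_{i∈S} zᵢ⁻¹)(∏_{i∈T} zᵢ)`. -/
def wST {R : Type*} [CommRing R] {ι : Type*} (z : ι → Rˣ) (S T : Finset ι) (s : ℤ) : R :=
  (∏ i ∈ S, ((z i : Rˣ) : R)) * (∏ i ∈ T, (((z i)⁻¹ : Rˣ) : R)) +
    (((-1 : Rˣ) ^ (s + (S.card : ℤ) + (T.card : ℤ)) : Rˣ) : R) *
      ((∏ i ∈ S, (((z i)⁻¹ : Rˣ) : R)) * ∏ i ∈ T, ((z i : Rˣ) : R))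

/-- `w_{A;S,T}^{(s)}` with the extra squared factor over `A`. -/
def wAST {R : Type*} [CommRing R] {ι : Type*} (z : ι → Rˣ) (A S T : Finset ι) (s : ℤ) : R :=
  (∏ i ∈ A, ((z i : Rˣ) : R) ^ 2) * (∏ i ∈ S, ((z i : Rˣ) : R)) *
      (∏ i ∈ T, (((z i)⁻¹ : Rˣ) : R)) +
    (((-1 : Rˣ) ^ (s + (S.card : ℤ) + (T.card : ℤ)) : Rˣ) : R) *
      ((∏ i ∈ A, (((z i)⁻¹ : Rˣ) : R) ^ 2) * (∏ i ∈ S, (((z i)⁻¹ : Rˣ) : R)) *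
        ∏ i ∈ T, ((z i : Rˣ) : R))

lemma aux_sign {R : Type*} [CommRing R] (s : ℤ) :
    (((-1 : Rˣ) ^ s : Rˣ) : R) * (((-1 : Rˣ) ^ s : Rˣ) : R) = 1 := by
  rw [← Units.val_mul, ← mul_zpow]; simp

lemma aux_nat {R : Type*} [CommRing R] (n : ℕ) : (-1 : R) ^ n * (-1 : R) ^ n = 1 := by
  rw [← mul_pow]; simp

/-- Relations (I) of Theorem 3.2, after complexification. -/
theorem relation_I {R : Type*} [CommRing R] {ι : Type*} [DecidableEq ι] (z : ι → Rˣ)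
    (A B C : Finset ι) (hAB : Disjoint A B) (hAC : Disjoint A C) (hBC : Disjoint B C)
    (s t : ℤ) :
    wS z (A ∪ B) s * wS z (A ∪ C) t =
      (∑ T ∈ A.powerset, (∏ i ∈ T, ww z i) * wS z (T ∪ B ∪ C) (s + t)) +
        (((-1 : Rˣ) ^ (s + (A.card : ℤ) + (B.card : ℤ)) : Rˣ) : R) *
          ∑ S' ∈ B.powerset,
            (-1 : R) ^ S'.card * (∏ i ∈ S', ww z i) * wS z (C ∪ (B \ S')) (s + t) := by
  have hz : ∀ i, ((z i : Rˣ) : R) * (((z i)⁻¹ : Rˣ) : R) = 1 := fun i => by simp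
  have hP : ∀ D : Finset ι, (∏ i ∈ D, ((z i : Rˣ) : R)) * ∏ i ∈ D, (((z i)⁻¹ : Rˣ) : R) = 1 := by
    intro D
    rw [← Finset.prod_mul_distrib]
    exact Finset.prod_eq_one (fun i _ => hz i)
  have hA1 : ∑ T ∈ A.powerset, (∏ i ∈ T, ww z i) * ∏ i ∈ T, ((z i : Rˣ) : R)
      = (∏ i ∈ A, ((z i : Rˣ) : R)) * ∏ i ∈ A, ((z i : Rˣ) : R) := by
    have h := Finset.prod_add (fun i => ww z i * ((z i : Rˣ) : R)) (fun _ => (1 : R)) A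
    simp only [Finset.prod_const_one, mul_one, Finset.prod_mul_distrib] at h
    rw [← h, ← Finset.prod_mul_distrib]
    refine Finset.prod_congr rfl fun i _ => ?_
    have := hz i
    unfold ww
    linear_combination -this
  have hA2 : ∑ T ∈ A.powerset, (-1 : R) ^ T.card * (∏ i ∈ T, ww z i) * ∏ i ∈ T, (((z i)⁻¹ : Rˣ) : R)
      = (∏ i ∈ A, (((z i)⁻¹ : Rˣ) : R)) * ∏ i ∈ A, (((z i)⁻¹ : Rˣ) : R) := by
    have h := Finset.prod_add (fun i => (-1 : R) * ww z i * (((z i)⁻¹ : Rˣ) : R)) (fun _ => (1 : R)) A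
    simp only [Finset.prod_const_one, mul_one, Finset.prod_mul_distrib, Finset.prod_const] at h
    rw [← h, ← Finset.prod_mul_distrib]
    refine Finset.prod_congr rfl fun i _ => ?_
    have := hz i
    unfold ww
    linear_combination -this
  have hB1 : ∑ T ∈ B.powerset, (-1 : R) ^ T.card * (∏ i ∈ T, ww z i) * ∏ i ∈ B \ T, ((z i : Rˣ) : R)
      = ∏ i ∈ B, (((z i)⁻¹ : Rˣ) : R) := by
    have h := Finset.prod_add (fun i => (-1 : R) * ww z i) (fun i => ((z i : Rˣ) : R)) B
    simp only [Finset.prod_mul_distrib, Finset.prod_const] at h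
    rw [← h]
    refine Finset.prod_congr rfl fun i _ => ?_
    unfold ww
    ring
  have hB2 : ∑ T ∈ B.powerset, (∏ i ∈ T, ww z i) * ∏ i ∈ B \ T, (((z i)⁻¹ : Rˣ) : R)
      = ∏ i ∈ B, ((z i : Rˣ) : R) := by
    rw [← Finset.prod_add]
    refine Finset.prod_congr rfl fun i _ => ?_
    unfold ww
    ring
  have hsum1 : ∑ T ∈ A.powerset, (∏ i ∈ T, ww z i) * wS z (T ∪ B ∪ C) (s + t) =
      (∏ i ∈ B, ((z i : Rˣ) : R)) * (∏ i ∈ C, ((z i : Rˣ) : R)) *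
        (∑ T ∈ A.powerset, (∏ i ∈ T, ww z i) * ∏ i ∈ T, ((z i : Rˣ) : R)) +
      (((-1 : Rˣ) ^ s : Rˣ) : R) * (((-1 : Rˣ) ^ t : Rˣ) : R) * (-1) ^ B.card * (-1) ^ C.card *
        (∏ i ∈ B, (((z i)⁻¹ : Rˣ) : R)) * (∏ i ∈ C, (((z i)⁻¹ : Rˣ) : R)) *
        ∑ T ∈ A.powerset, (-1 : R) ^ T.card * (∏ i ∈ T, ww z i) *
          ∏ i ∈ T, (((z i)⁻¹ : Rˣ) : R) := by
    rw [Finset.mul_sum, Finset.mul_sum, ← Finset.sum_add_distrib]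
    refine Finset.sum_congr rfl fun T hT => ?_
    have hTA := Finset.mem_powerset.1 hT
    have h1 : Disjoint T B := Finset.disjoint_of_subset_left hTA hAB
    have h2 : Disjoint (T ∪ B) C :=
      Finset.disjoint_union_left.2 ⟨Finset.disjoint_of_subset_left hTA hAC, hBC⟩
    unfold wS
    rw [Finset.prod_union h2, Finset.prod_union h1, Finset.prod_union h2, Finset.prod_union h1,
      Finset.card_union_of_disjoint h2, Finset.card_union_of_disjoint h1]
    simp only [Nat.cast_add, zpow_add, zpow_natCast, Units.val_mul, Units.val_pow_eq_pow_val,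
      Units.val_neg, Units.val_one]
    ring
  have hsum2 : ∑ S' ∈ B.powerset,
        (-1 : R) ^ S'.card * (∏ i ∈ S', ww z i) * wS z (C ∪ (B \ S')) (s + t) =
      (∏ i ∈ C, ((z i : Rˣ) : R)) *
        (∑ T ∈ B.powerset, (-1 : R) ^ T.card * (∏ i ∈ T, ww z i) *
          ∏ i ∈ B \ T, ((z i : Rˣ) : R)) +
      (((-1 : Rˣ) ^ s : Rˣ) : R) * (((-1 : Rˣ) ^ t : Rˣ) : R) * (-1) ^ B.card * (-1) ^ C.card *
        (∏ i ∈ C, (((z i)⁻¹ : Rˣ) : R)) *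
        ∑ T ∈ B.powerset, (∏ i ∈ T, ww z i) * ∏ i ∈ B \ T, (((z i)⁻¹ : Rˣ) : R) := by
    rw [Finset.mul_sum, Finset.mul_sum, ← Finset.sum_add_distrib]
    refine Finset.sum_congr rfl fun T hT => ?_
    have hTB := Finset.mem_powerset.1 hT
    have h1 : Disjoint C (B \ T) :=
      (Finset.disjoint_of_subset_left Finset.sdiff_subset hBC).symm
    have hc : (-1 : R) ^ B.card = (-1) ^ (B \ T).card * (-1) ^ T.card := by
      rw [← pow_add, Finset.card_sdiff_add_card_eq_card hTB]
    unfold wS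
    rw [Finset.prod_union h1, Finset.prod_union h1, Finset.card_union_of_disjoint h1, hc]
    simp only [Nat.cast_add, zpow_add, zpow_natCast, Units.val_mul, Units.val_pow_eq_pow_val,
      Units.val_neg, Units.val_one]
    ring
  rw [hsum1, hsum2, hA1, hA2, hB1, hB2]
  unfold wS
  rw [Finset.prod_union hAB, Finset.prod_union hAB, Finset.prod_union hAC, Finset.prod_union hAC,
    Finset.card_union_of_disjoint hAB, Finset.card_union_of_disjoint hAC]
  simp only [Nat.cast_add, zpow_add, zpow_natCast, Units.val_mul, Units.val_pow_eq_pow_val,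
    Units.val_neg, Units.val_one]
  have hs := aux_sign (R := R) s
  have ha := aux_nat (R := R) A.card
  have hb := aux_nat (R := R) B.card
  have hPA := hP A
  generalize (((-1 : Rˣ) ^ s : Rˣ) : R) = σ at *
  generalize (((-1 : Rˣ) ^ t : Rˣ) : R) = τ at *
  generalize (-1 : R) ^ A.card = a at *
  generalize (-1 : R) ^ B.card = b at *
  generalize (-1 : R) ^ C.card = c at *
  generalize (∏ i ∈ A, ((z i : Rˣ) : R)) = x at *
  generalize (∏ i ∈ A, (((z i)⁻¹ : Rˣ) : R)) = x' at *
  generalize (∏ i ∈ B, ((z i : Rˣ) : R)) = y at *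
  generalize (∏ i ∈ B, (((z i)⁻¹ : Rˣ) : R)) = y' at *
  generalize (∏ i ∈ C, ((z i : Rˣ) : R)) = u at *
  generalize (∏ i ∈ C, (((z i)⁻¹ : Rˣ) : R)) = u' at *
  clear hsum1 hsum2 hA1 hA2 hB1 hB2 hP hz
  linear_combination (σ * a * b * y' * u + τ * a * c * y * u') * hPA
    + (σ * τ * b * c * x' * x' * y' * u') * ha
    - (τ * a * c * y * u' * b * b) * hs - (τ * a * c * y * u') * hb
end

section
/- For a finite subset S of ι, an element i ∈ ι with i ∉ S, and an integer s, the following identity holds in R: wᵢ · w_S^{(s)} = (−1)^s · ∑_{T⊆S} (−1)^{|T|} (∏_{j∈S∖T} w_j) · w_{{i}∪T}^{(s)} + w_{{i}∪S}^{(s)}, where the sum runs over all subsets T of S. (This is the identity, after complexification, expressing relations (II) of Theorem 3.2 describing the ring KO*(BT^m).) -/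
open Finset

/-- Relations (II) of Theorem 3.2, after complexification. -/
theorem relation_II {R : Type*} [CommRing R] {ι : Type*} [DecidableEq ι] (z : ι → Rˣ)
    (S : Finset ι) (i : ι) (hi : i ∉ S) (s : ℤ) :
    ww z i * wS z S s =
      (((-1 : Rˣ) ^ s : Rˣ) : R) *
          (∑ T ∈ S.powerset,
            (-1 : R) ^ T.card * (∏ j ∈ S \ T, ww z j) * wS z (insert i T) s) +
        wS z (insert i S) s := by
  have hc : (((-1 : Rˣ) ^ s : Rˣ) : R) * (((-1 : Rˣ) ^ s : Rˣ) : R) = 1 := by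
    rw [← Units.val_mul, ← mul_zpow]; simp
  have h1 := Finset.prod_add (fun j => -((z j : Rˣ) : R)) (fun j => ww z j) S
  have h2 := Finset.prod_add (fun j => (((z j)⁻¹ : Rˣ) : R)) (fun j => ww z j) S
  have e1 : ∀ j, -((z j : Rˣ) : R) + ww z j = -(((z j)⁻¹ : Rˣ) : R) := by
    intro j; unfold ww; ring
  have e2 : ∀ j, (((z j)⁻¹ : Rˣ) : R) + ww z j = ((z j : Rˣ) : R) := by
    intro j; unfold ww; ring
  simp only [e1, e2, Finset.prod_neg] at h1 h2
  have key : (∑ T ∈ S.powerset,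
      (-1 : R) ^ T.card * (∏ j ∈ S \ T, ww z j) * wS z (insert i T) s) =
      ((z i : Rˣ) : R) * ((-1) ^ S.card * ∏ j ∈ S, (((z j)⁻¹ : Rˣ) : R)) -
      (((-1 : Rˣ) ^ s : Rˣ) : R) * (((z i)⁻¹ : Rˣ) : R) * ∏ j ∈ S, ((z j : Rˣ) : R) := by
    rw [h1, h2, Finset.mul_sum, Finset.mul_sum, ← Finset.sum_sub_distrib]
    refine Finset.sum_congr rfl fun T hT => ?_
    have hiT : i ∉ T := fun h => hi (Finset.mem_powerset.1 hT h)
    have hs : (-1 : R) ^ T.card * (-1) ^ T.card = 1 := by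
      rw [← mul_pow]; simp
    unfold wS
    rw [Finset.prod_insert hiT, Finset.prod_insert hiT, Finset.card_insert_of_notMem hiT,
      zpow_add, zpow_natCast]
    push_cast
    rw [pow_succ]
    linear_combination (-(∏ j ∈ S \ T, ww z j) * (((-1 : Rˣ) ^ s : Rˣ) : R) *
      (((z i)⁻¹ : Rˣ) : R) * ∏ j ∈ T, (((z j)⁻¹ : Rˣ) : R)) * hs
  rw [key]
  unfold wS ww
  rw [Finset.prod_insert hi, Finset.prod_insert hi, Finset.card_insert_of_notMem hi,
    zpow_add, zpow_add, zpow_natCast, zpow_natCast]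
  push_cast
  rw [pow_succ]
  push_cast at hc
  linear_combination ((((z i)⁻¹ : Rˣ) : R) * ∏ j ∈ S, ((z j : Rˣ) : R)) * hc
end

section
/- For pairwise disjoint finite subsets A, B, C of ι and integers s, t, the following identity holds in R: w_{A∪B}^{(s)} · w_{A∪C}^{(t)} = w_{A;B∪C,∅}^{(s+t)} + (−1)^{s+|A|+|B|} · w_{C,B}^{(s+t)}. -/
open Finset

theorem aux_sq {R : Type*} [CommRing R] (n : ℤ) :
    (((-1 : Rˣ) ^ n : Rˣ) : R) * (((-1 : Rˣ) ^ n : Rˣ) : R) = 1 := by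
  rw [← Units.val_mul, ← mul_zpow]
  simp

/-- The closed form (3.4) for the left-hand side of relation (I). -/
theorem lhs_relation_I {R : Type*} [CommRing R] {ι : Type*} [DecidableEq ι] (z : ι → Rˣ)
    (A B C : Finset ι) (hAB : Disjoint A B) (hAC : Disjoint A C) (hBC : Disjoint B C)
    (s t : ℤ) :
    wS z (A ∪ B) s * wS z (A ∪ C) t =
      wAST z A (B ∪ C) ∅ (s + t) +
        (((-1 : Rˣ) ^ (s + (A.card : ℤ) + (B.card : ℤ)) : Rˣ) : R) * wST z C B (s + t) := by
  have ha : (∏ i ∈ A, ((z i : Rˣ) : R)) * (∏ i ∈ A, (((z i)⁻¹ : Rˣ) : R)) = 1 := by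
    rw [← Finset.prod_mul_distrib]
    simp
  have hS := aux_sq (R := R) s
  have hα := aux_sq (R := R) (A.card : ℤ)
  have hβ := aux_sq (R := R) (B.card : ℤ)
  unfold wS wAST wST
  rw [Finset.prod_union hAB, Finset.prod_union hAB, Finset.prod_union hAC, Finset.prod_union hAC,
    Finset.prod_union hBC, Finset.prod_union hBC, Finset.card_union_of_disjoint hAB,
    Finset.card_union_of_disjoint hAC, Finset.card_union_of_disjoint hBC]
  simp only [Nat.cast_add, Finset.card_empty, Nat.cast_zero, add_zero, Finset.prod_empty, mul_one,
    zpow_add, Units.val_mul, Finset.prod_pow]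
  generalize (((-1 : Rˣ) ^ s : Rˣ) : R) = S at *
  generalize (((-1 : Rˣ) ^ t : Rˣ) : R) = T at *
  generalize (((-1 : Rˣ) ^ (A.card : ℤ) : Rˣ) : R) = α at *
  generalize (((-1 : Rˣ) ^ (B.card : ℤ) : Rˣ) : R) = β at *
  generalize (((-1 : Rˣ) ^ (C.card : ℤ) : Rˣ) : R) = γ at *
  generalize (∏ i ∈ A, ((z i : Rˣ) : R)) = a at *
  generalize (∏ i ∈ A, (((z i)⁻¹ : Rˣ) : R)) = a' at *
  generalize (∏ i ∈ B, ((z i : Rˣ) : R)) = b at *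
  generalize (∏ i ∈ B, (((z i)⁻¹ : Rˣ) : R)) = b' at *
  generalize (∏ i ∈ C, ((z i : Rˣ) : R)) = c at *
  generalize (∏ i ∈ C, (((z i)⁻¹ : Rˣ) : R)) = c' at *
  linear_combination (T * α * γ * b * c' + S * α * β * b' * c) * ha +
    S * T * β * γ * a' ^ 2 * b' * c' * hα - T * α * γ * b * c' * β ^ 2 * hS -
    T * α * γ * b * c' * hβ
end

section
/- For a finite subset S of ι, an element i ∈ ι with i ∉ S, and an integer s, the following identity holds in R: wᵢ · w_S^{(s)} = −w_{S,{i}}^{(s)} + w_{{i}∪S}^{(s)}. -/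
open Finset

/-- The closed form (3.13) for the left-hand side of relation (II). -/
theorem lhs_relation_II {R : Type*} [CommRing R] {ι : Type*} [DecidableEq ι] (z : ι → Rˣ)
    (S : Finset ι) (i : ι) (hi : i ∉ S) (s : ℤ) :
    ww z i * wS z S s = -wST z S {i} s + wS z (insert i S) s := by
  have h : (-1 : Rˣ) ^ (s + (S.card : ℤ) + 1) = -((-1 : Rˣ) ^ (s + (S.card : ℤ))) := by
    rw [zpow_add_one, mul_neg, mul_one]
  unfold ww wS wST
  rw [Finset.prod_insert hi, Finset.prod_insert hi, Finset.card_insert_of_notMem hi,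
    Finset.prod_singleton, Finset.prod_singleton, Finset.card_singleton, Nat.cast_add,
    Nat.cast_one, ← add_assoc s (S.card : ℤ) 1, h, Units.val_neg]
  ring
end

section
/- For disjoint finite subsets A and D of ι and any integer s, the following identity holds in R: ∑_{T⊆A} (∏_{i∈T} wᵢ) · w_{T∪D}^{(s)} = w_{A;D,∅}^{(s)}, where the sum runs over all subsets T of A. -/
open Finset

/-- The first term of the right-hand side of (3.3) collapses to `w_{A;D,∅}^{(s)}`. -/
theorem rhs_first_term {R : Type*} [CommRing R] {ι : Type*} [DecidableEq ι] (z : ι → Rˣ)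
    (A D : Finset ι) (hAD : Disjoint A D) (s : ℤ) :
    ∑ T ∈ A.powerset, (∏ i ∈ T, ww z i) * wS z (T ∪ D) s = wAST z A D ∅ s := by
  have h1 : ∀ i, ((z i : Rˣ) : R) ^ 2 = 1 + ww z i * ((z i : Rˣ) : R) := by
    intro i
    have h := Units.inv_mul (z i)
    unfold ww
    linear_combination h
  have h2 : ∀ i, (((z i)⁻¹ : Rˣ) : R) ^ 2 = 1 + ww z i * (-(((z i)⁻¹ : Rˣ) : R)) := by
    intro i
    have h := Units.inv_mul (z i)
    unfold ww
    linear_combination h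
  unfold wAST
  simp only [h1, h2, Finset.prod_one_add, Finset.prod_empty, Finset.card_empty, mul_one,
    Nat.cast_zero, add_zero, Finset.sum_mul, Finset.mul_sum]
  rw [← Finset.sum_add_distrib]
  refine Finset.sum_congr rfl fun T hT => ?_
  have hd : Disjoint T D := Finset.disjoint_of_subset_left (Finset.mem_powerset.mp hT) hAD
  unfold wS
  rw [Finset.prod_union hd, Finset.prod_union hd, Finset.card_union_of_disjoint hd,
    Finset.prod_mul_distrib, Finset.prod_mul_distrib, Finset.prod_neg]
  have h3 : (((-1 : Rˣ) ^ (s + ((T.card + D.card : ℕ) : ℤ)) : Rˣ) : R)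
      = (((-1 : Rˣ) ^ (s + (D.card : ℤ)) : Rˣ) : R) * (-1) ^ T.card := by
    have : s + ((T.card + D.card : ℕ) : ℤ) = (s + (D.card : ℤ)) + (T.card : ℤ) := by
      push_cast; ring
    rw [this, zpow_add, zpow_natCast]
    simp
  rw [h3]
  ring
end

section
/- For disjoint finite subsets T and D of ι and any integer s, the following identity holds in R: (∏_{i∈T} wᵢ) · w_{T∪D}^{(s)} = ∑_{R'⊆T} (−1)^{|T∖R'|} · w_{R';D,∅}^{(s)}, where the sum runs over all subsets R' of T. -/
open Finset

/-- The expansion (3.5) of a single summand of the first term. -/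
theorem summand_expansion {R : Type*} [CommRing R] {ι : Type*} [DecidableEq ι] (z : ι → Rˣ)
    (T D : Finset ι) (hTD : Disjoint T D) (s : ℤ) :
    (∏ i ∈ T, ww z i) * wS z (T ∪ D) s =
      ∑ R' ∈ T.powerset, (-1 : R) ^ ((T \ R').card) * wAST z R' D ∅ s := by
  have h1 : (∏ i ∈ T, ww z i) * (∏ i ∈ T, ((z i : Rˣ) : R)) =
      ∑ A ∈ T.powerset, (-1 : R) ^ ((T \ A).card) * ∏ i ∈ A, ((z i : Rˣ) : R) ^ 2 := by
    have h : ∀ i ∈ T, ww z i * ((z i : Rˣ) : R) = ((z i : Rˣ) : R) ^ 2 + (-1) := by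
      intro i _
      have := (z i).inv_mul
      unfold ww
      linear_combination -this
    rw [← Finset.prod_mul_distrib, Finset.prod_congr rfl h, Finset.prod_add]
    refine Finset.sum_congr rfl fun A _ => ?_
    rw [Finset.prod_const, mul_comm]
  have h2 : (∏ i ∈ T, ww z i) * ((-1) ^ T.card * ∏ i ∈ T, (((z i)⁻¹ : Rˣ) : R)) =
      ∑ A ∈ T.powerset, (-1 : R) ^ ((T \ A).card) * ∏ i ∈ A, (((z i)⁻¹ : Rˣ) : R) ^ 2 := by
    have h : ∀ i ∈ T, ww z i * ((-1) * (((z i)⁻¹ : Rˣ) : R)) =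
        (((z i)⁻¹ : Rˣ) : R) ^ 2 + (-1) := by
      intro i _
      have := (z i).inv_mul
      unfold ww
      linear_combination -this
    rw [← Finset.prod_const, ← Finset.prod_mul_distrib, ← Finset.prod_mul_distrib,
      Finset.prod_congr rfl h, Finset.prod_add]
    refine Finset.sum_congr rfl fun A _ => ?_
    rw [Finset.prod_const, mul_comm]
  have hs : (((-1 : Rˣ) ^ (s + ((T ∪ D).card : ℤ)) : Rˣ) : R) =
      (((-1 : Rˣ) ^ (s + (D.card : ℤ)) : Rˣ) : R) * (-1) ^ T.card := by
    rw [Finset.card_union_of_disjoint hTD, Nat.cast_add, add_comm (T.card : ℤ), ← add_assoc,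
      zpow_add _ _ (T.card : ℤ), zpow_natCast]
    simp
  have hR : ∀ A ∈ T.powerset, (-1 : R) ^ ((T \ A).card) * wAST z A D ∅ s =
      ((-1 : R) ^ ((T \ A).card) * ∏ i ∈ A, ((z i : Rˣ) : R) ^ 2) * (∏ i ∈ D, ((z i : Rˣ) : R)) +
      ((-1 : R) ^ ((T \ A).card) * ∏ i ∈ A, (((z i)⁻¹ : Rˣ) : R) ^ 2) *
        ((((-1 : Rˣ) ^ (s + (D.card : ℤ)) : Rˣ) : R) * ∏ i ∈ D, (((z i)⁻¹ : Rˣ) : R)) := by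
    intro A _
    unfold wAST
    simp only [Finset.prod_empty, Finset.card_empty, Nat.cast_zero, add_zero, mul_one]
    ring
  rw [Finset.sum_congr rfl hR, Finset.sum_add_distrib, ← Finset.sum_mul, ← Finset.sum_mul,
    ← h1, ← h2]
  unfold wS
  rw [hs, Finset.prod_union hTD, Finset.prod_union hTD]
  ring
end

section
/- For disjoint finite subsets B and C of ι and any integer s, the following identity holds in R: ∑_{S⊆B} (−1)^{|S|} (∏_{i∈S} wᵢ) · w_{C∪(B∖S)}^{(s)} = w_{C,B}^{(s)}, where the sum runs over all subsets S of B. -/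
open Finset

/-- The second term of the right-hand side of (3.3) collapses to `w_{C,B}^{(s)}`. -/
theorem rhs_second_term {R : Type*} [CommRing R] {ι : Type*} [DecidableEq ι] (z : ι → Rˣ)
    (B C : Finset ι) (hBC : Disjoint B C) (s : ℤ) :
    ∑ S' ∈ B.powerset,
        (-1 : R) ^ S'.card * (∏ i ∈ S', ww z i) * wS z (C ∪ (B \ S')) s =
      wST z C B s := by
  have h1 : ∏ i ∈ B, (((z i)⁻¹ : Rˣ) : R) =
      ∑ S' ∈ B.powerset, (∏ i ∈ S', (-ww z i)) * ∏ i ∈ B \ S', ((z i : Rˣ) : R) := by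
    rw [← Finset.prod_add]
    refine Finset.prod_congr rfl fun i _ => ?_
    unfold ww
    ring
  have h2 : ∏ i ∈ B, (-((z i : Rˣ) : R)) =
      ∑ S' ∈ B.powerset, (∏ i ∈ S', (-ww z i)) * ∏ i ∈ B \ S', (-(((z i)⁻¹ : Rˣ) : R)) := by
    rw [← Finset.prod_add]
    refine Finset.prod_congr rfl fun i _ => ?_
    unfold ww
    ring
  have h3 : wST z C B s = (∏ i ∈ C, ((z i : Rˣ) : R)) * (∏ i ∈ B, (((z i)⁻¹ : Rˣ) : R)) +
      (((-1 : Rˣ) ^ (s + (C.card : ℤ)) : Rˣ) : R) * (∏ i ∈ C, (((z i)⁻¹ : Rˣ) : R)) *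
        ∏ i ∈ B, (-((z i : Rˣ) : R)) := by
    rw [Finset.prod_neg, wST, zpow_add _ (s + (C.card : ℤ)), zpow_natCast]
    push_cast
    ring
  rw [h3, h1, h2, Finset.mul_sum, Finset.mul_sum, ← Finset.sum_add_distrib]
  refine Finset.sum_congr rfl fun S' _ => ?_
  have hd : Disjoint C (B \ S') := (hBC.mono_left Finset.sdiff_subset).symm
  rw [wS, Finset.prod_union hd, Finset.prod_union hd, Finset.card_union_of_disjoint hd,
    Finset.prod_neg, Finset.prod_neg, Nat.cast_add, ← add_assoc,
    zpow_add _ (s + (C.card : ℤ)), zpow_natCast]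
  push_cast
  ring
end

section
/- For disjoint finite subsets B and C of ι, a subset S ⊆ B, and any integer s, the following identity holds in R: (∏_{i∈S} wᵢ) · w_{C∪(B∖S)}^{(s)} = ∑_{U⊆S} (−1)^{|U|} · w_{C∪(B∖U),U}^{(s)}, where the sum runs over all subsets U of S. -/
open Finset

/-- The expansion (3.9) of a single summand of the second term. -/
theorem summand_expansion_second {R : Type*} [CommRing R] {ι : Type*} [DecidableEq ι]
    (z : ι → Rˣ) (B C : Finset ι) (hBC : Disjoint B C) (S : Finset ι) (hSB : S ⊆ B) (s : ℤ) :
    (∏ i ∈ S, ww z i) * wS z (C ∪ (B \ S)) s =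
      ∑ U ∈ S.powerset, (-1 : R) ^ U.card * wST z (C ∪ (B \ U)) U s := by
  have hU : ∀ U ∈ S.powerset, Disjoint (C ∪ (B \ S)) (S \ U) ∧
      C ∪ (B \ U) = (C ∪ (B \ S)) ∪ (S \ U) := by
    intro U hU
    rw [mem_powerset] at hU
    constructor
    · rw [Finset.disjoint_left] at hBC ⊢
      intro a ha hb
      simp only [mem_union, mem_sdiff] at ha hb
      have := hSB hb.1
      have := hBC this
      tauto
    · ext a
      have h1 := @hU a
      have h2 := @hSB a
      simp only [mem_union, mem_sdiff]
      tauto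
  have e1 : (∏ i ∈ S, ww z i) = ∑ U ∈ S.powerset, (-1 : R) ^ U.card *
      ((∏ i ∈ S \ U, ((z i : Rˣ) : R)) * ∏ i ∈ U, (((z i)⁻¹ : Rˣ) : R)) := by
    have : ∀ i ∈ S, ww z i = -(((z i)⁻¹ : Rˣ) : R) + ((z i : Rˣ) : R) := by
      intro i _
      unfold ww
      ring
    rw [prod_congr rfl this, prod_add]
    refine sum_congr rfl fun U _ => ?_
    rw [prod_neg]
    ring
  have e2 : (∏ i ∈ S, ww z i) = ∑ U ∈ S.powerset, (-1 : R) ^ (S \ U).card *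
      ((∏ i ∈ S \ U, (((z i)⁻¹ : Rˣ) : R)) * ∏ i ∈ U, ((z i : Rˣ) : R)) := by
    have : ∀ i ∈ S, ww z i = ((z i : Rˣ) : R) + -(((z i)⁻¹ : Rˣ) : R) := by
      intro i _
      unfold ww
      ring
    rw [prod_congr rfl this, prod_add]
    refine sum_congr rfl fun U _ => ?_
    rw [prod_neg]
    ring
  unfold wS
  rw [mul_add]
  nth_rewrite 1 [e1]
  rw [e2, sum_mul, sum_mul, ← sum_add_distrib]
  refine sum_congr rfl fun U h => ?_
  obtain ⟨hd, he⟩ := hU U h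
  unfold wST
  rw [he, prod_union hd, prod_union hd, card_union_of_disjoint hd]
  have hs : ((-1 : R) ^ U.card) * (-1 : R) ^ U.card = 1 := by
    rw [← mul_pow]
    simp
  push_cast
  rw [← add_assoc, zpow_add _ _ (U.card : ℤ), zpow_add _ _ ((S \ U).card : ℤ)]
  simp only [zpow_natCast, Units.val_mul, Units.val_pow_eq_pow_val, Units.val_neg, Units.val_one]
  generalize ((((-1 : Rˣ) ^ (s + ((C ∪ (B \ S)).card : ℤ)) : Rˣ)) : R) = e
  linear_combination (-(e * (-1 : R) ^ (S \ U).card *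
    (∏ i ∈ C ∪ (B \ S), (((z i)⁻¹ : Rˣ) : R)) * (∏ i ∈ S \ U, (((z i)⁻¹ : Rˣ) : R)) *
    ∏ i ∈ U, ((z i : Rˣ) : R))) * hs
end

section
/- For a finite subset S of ι, an element i ∈ ι with i ∉ S, a subset T ⊆ S, and any integer s, the following identity holds in R: w_{{i}∪T}^{(s)} · ∏_{j∈S∖T} w_j = ∑_{B⊆S∖T} (−1)^{|B|} · w_{{i}∪(S∖B),B}^{(s)}, where the sum runs over all subsets B of S∖T. -/
open Finset

theorem prod_sub_powerset_aux {R : Type*} [CommRing R] {ι : Type*} [DecidableEq ι]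
    (f g : ι → R) (U : Finset ι) :
    ∏ j ∈ U, (f j - g j) =
      ∑ B ∈ U.powerset, (-1 : R) ^ B.card * ((∏ j ∈ U \ B, f j) * ∏ j ∈ B, g j) := by
  have h := Finset.prod_add (fun j => - g j) f U
  have h2 : ∏ j ∈ U, (f j - g j) = ∏ j ∈ U, (- g j + f j) :=
    Finset.prod_congr rfl fun j _ => by ring
  rw [h2, h]
  refine Finset.sum_congr rfl fun B _ => ?_
  rw [Finset.prod_neg]
  ring

theorem prod_insert_sdiff_aux {R : Type*} [CommRing R] {ι : Type*} [DecidableEq ι]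
    (f : ι → R) (S T B : Finset ι) (i : ι) (hi : i ∉ S) (hTS : T ⊆ S) (hB : B ⊆ S \ T) :
    ∏ j ∈ insert i (S \ B), f j = (∏ j ∈ insert i T, f j) * ∏ j ∈ (S \ T) \ B, f j := by
  have hU : insert i (S \ B) = insert i T ∪ ((S \ T) \ B) := by
    ext x
    have h1 := @hTS x
    have h2 := @hB x
    simp only [mem_insert, mem_union, mem_sdiff] at *
    tauto
  rw [hU, Finset.prod_union]
  rw [Finset.disjoint_left]
  intro x hx hx'
  simp only [mem_insert, mem_sdiff] at hx hx'
  rcases hx with rfl | hx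
  · exact hi hx'.1.1
  · exact hx'.1.2 hx

/-- The expansion of a summand appearing in the verification of relation (II). -/
theorem summand_expansion_relII {R : Type*} [CommRing R] {ι : Type*} [DecidableEq ι]
    (z : ι → Rˣ) (S : Finset ι) (i : ι) (hi : i ∉ S) (T : Finset ι) (hTS : T ⊆ S) (s : ℤ) :
    wS z (insert i T) s * (∏ j ∈ S \ T, ww z j) =
      ∑ B ∈ (S \ T).powerset, (-1 : R) ^ B.card * wST z (insert i (S \ B)) B s := by
  have e1 := prod_sub_powerset_aux (fun j => ((z j : Rˣ) : R)) (fun j => (((z j)⁻¹ : Rˣ) : R)) (S \ T)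
  have e2 := prod_sub_powerset_aux (fun j => (((z j)⁻¹ : Rˣ) : R)) (fun j => ((z j : Rˣ) : R)) (S \ T)
  have e3 : ∏ j ∈ S \ T, ww z j = (-1 : R) ^ (S \ T).card *
      ∏ j ∈ S \ T, ((((z j)⁻¹ : Rˣ) : R) - ((z j : Rˣ) : R)) := by
    rw [← Finset.prod_neg]
    exact Finset.prod_congr rfl fun j _ => by simp [ww]
  have e4 : ∏ j ∈ S \ T, ww z j = ∏ j ∈ S \ T, (((z j : Rˣ) : R) - (((z j)⁻¹ : Rˣ) : R)) := rfl
  rw [wS, add_mul]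
  nth_rewrite 1 [e4]
  rw [e3, e1, e2]
  simp only [Finset.mul_sum]
  rw [← Finset.sum_add_distrib]
  refine Finset.sum_congr rfl fun B hB => ?_
  rw [Finset.mem_powerset] at hB
  have hBS : B ⊆ S := hB.trans Finset.sdiff_subset
  have hs : (((-1 : Rˣ) ^ (s + ((insert i (S \ B)).card : ℤ) + (B.card : ℤ)) : Rˣ) : R) =
      (((-1 : Rˣ) ^ (s + ((insert i T).card : ℤ)) : Rˣ) : R) * (-1 : R) ^ (S \ T).card := by
    have hc : s + ((insert i (S \ B)).card : ℤ) + (B.card : ℤ) =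
        s + ((insert i T).card : ℤ) + ((S \ T).card : ℤ) := by
      rw [Finset.card_insert_of_notMem (fun h => hi (Finset.mem_sdiff.1 h).1),
        Finset.card_insert_of_notMem (fun h => hi (hTS h))]
      have h1 := Finset.card_sdiff_add_card_eq_card hBS
      have h2 := Finset.card_sdiff_add_card_eq_card hTS
      omega
    rw [hc, zpow_add _ _ ((S \ T).card : ℤ), zpow_natCast]
    push_cast
    rfl
  rw [wST, hs, prod_insert_sdiff_aux _ S T B i hi hTS hB, prod_insert_sdiff_aux _ S T B i hi hTS hB]
  ring
end

section
/- For a finite subset S of ι, an element i ∈ ι with i ∉ S, and any integer s, the following identity holds in R: (−1)^s · ∑_{T⊆S} (−1)^{|T|} (∏_{j∈S∖T} w_j) · w_{{i}∪T}^{(s)} = −w_{S,{i}}^{(s)}, where the sum runs over all subsets T of S. -/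
open Finset

/-- The first term of the right-hand side of relation (II) collapses to `−w_{S,{i}}^{(s)}`. -/
theorem relII_first_term {R : Type*} [CommRing R] {ι : Type*} [DecidableEq ι]
    (z : ι → Rˣ) (S : Finset ι) (i : ι) (hi : i ∉ S) (s : ℤ) :
    (((-1 : Rˣ) ^ s : Rˣ) : R) *
        ∑ T ∈ S.powerset,
          (-1 : R) ^ T.card * (∏ j ∈ S \ T, ww z j) * wS z (insert i T) s =
      -wST z S {i} s := by
  have h1 : ∑ T ∈ S.powerset, (∏ j ∈ T, (-((z j : Rˣ) : R))) * (∏ j ∈ S \ T, ww z j)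
      = (-1 : R) ^ S.card * ∏ j ∈ S, (((z j)⁻¹ : Rˣ) : R) := by
    rw [← Finset.prod_add, ← Finset.prod_neg]
    exact Finset.prod_congr rfl fun j _ => by simp only [ww]; ring
  have h2 : ∑ T ∈ S.powerset, (∏ j ∈ T, (((z j)⁻¹ : Rˣ) : R)) * (∏ j ∈ S \ T, ww z j)
      = ∏ j ∈ S, ((z j : Rˣ) : R) := by
    rw [← Finset.prod_add]
    exact Finset.prod_congr rfl fun j _ => by simp only [ww]; ring
  have hs : (((-1 : Rˣ) ^ s : Rˣ) : R) * (((-1 : Rˣ) ^ s : Rˣ) : R) = 1 := by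
    rw [← Units.val_mul, ← mul_zpow]; simp
  have key : ∑ T ∈ S.powerset,
          (-1 : R) ^ T.card * (∏ j ∈ S \ T, ww z j) * wS z (insert i T) s
      = ((z i : Rˣ) : R) * ((-1 : R) ^ S.card * ∏ j ∈ S, (((z j)⁻¹ : Rˣ) : R))
        - (((-1 : Rˣ) ^ s : Rˣ) : R) * (((z i)⁻¹ : Rˣ) : R) * ∏ j ∈ S, ((z j : Rˣ) : R) := by
    rw [← h1, ← h2, Finset.mul_sum, Finset.mul_sum, ← Finset.sum_sub_distrib]
    refine Finset.sum_congr rfl fun T hT => ?_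
    have hiT : i ∉ T := fun h => hi (Finset.mem_powerset.mp hT h)
    have e : (-1 : R) ^ T.card * (-1 : R) ^ T.card = 1 := by
      rw [← mul_pow]; simp
    have hc : (((-1 : Rˣ) ^ (s + ((insert i T).card : ℤ)) : Rˣ) : R)
        = -((((-1 : Rˣ) ^ s : Rˣ) : R) * (-1 : R) ^ T.card) := by
      rw [Finset.card_insert_of_notMem hiT, zpow_add, zpow_natCast, pow_succ]
      simp
    rw [wS, hc, Finset.prod_insert hiT, Finset.prod_insert hiT, Finset.prod_neg]
    linear_combination (-(((-1 : Rˣ) ^ s : Rˣ) : R) * (((z i)⁻¹ : Rˣ) : R) *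
      (∏ j ∈ T, (((z j)⁻¹ : Rˣ) : R)) * (∏ j ∈ S \ T, ww z j)) * e
  have hc : (((-1 : Rˣ) ^ (s + (S.card : ℤ) + (({i} : Finset ι).card : ℤ)) : Rˣ) : R)
      = -((((-1 : Rˣ) ^ s : Rˣ) : R) * (-1 : R) ^ S.card) := by
    rw [Finset.card_singleton, zpow_add, zpow_add, zpow_natCast]
    simp
  rw [key, wST, hc, Finset.prod_singleton, Finset.prod_singleton]
  linear_combination (-(((z i)⁻¹ : Rˣ) : R) * ∏ j ∈ S, ((z j : Rˣ) : R)) * hs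
end
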